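/- Let 1 ≤ r ≤ d − 1 and n ≥ 1 be integers and σ > 0. Let z₁, …, z_r be i.i.d. N(0, I_d) random vectors, set M := Σ_{i=1}^r z_i z_iᵀ, and let E ∈ ℝ^{d×n} have i.i.d. N(0,1) entries, independent of M. Let V, V′ ∈ ℝ^{d×n} with ΔV := V − V′ ≠ 0 of rank s, and define Y := M(V + σE), Y′ := M(V′ + σE). Fix ε > 0 and α ∈ (0,1), set μ̄ := α‖ΔV‖_F²/σ², δ_E(ε,α) := Φ((−ε − μ̄/2)/√μ̄) + 1 − Φ((ε − μ̄/2)/√μ̄), and δ_M := s·(1 − I_α(r/2, (d−r)/2)). Then for every Borel set A ⊆ ℝ^{d×n}, ℙ(Y ∈ A) ≤ e^{ε}·ℙ(Y′ ∈ A) + δ_E(ε,α) + δ_M. -/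

import Mathlib

open MeasureTheory ProbabilityTheory Matrix

/-- Standard normal CDF. -/
noncomputable def Phi (x : ℝ) : ℝ := ((gaussianReal 0 1) (Set.Iic x)).toReal

/-- Regularized incomplete beta function `I_x(a,b)`: the CDF of the `Beta(a,b)`
distribution at `x`. -/
noncomputable def regIncBeta (a b x : ℝ) : ℝ :=
  (∫ t in (0 : ℝ)..x, t ^ (a - 1) * (1 - t) ^ (b - 1))
    / ∫ t in (0 : ℝ)..1, t ^ (a - 1) * (1 - t) ^ (b - 1)

section

open scoped ENNReal

section PiDensity

theorem lintegral_fin_prod_eq_prod {n : ℕ} {E : Fin n → Type*}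
    {mE : ∀ i, MeasurableSpace (E i)} (μ : (i : Fin n) → Measure (E i)) [∀ i, SigmaFinite (μ i)]
    (f : (i : Fin n) → E i → ℝ≥0∞) (hf : ∀ i, Measurable (f i)) :
    ∫⁻ x : (i : Fin n) → E i, ∏ i, f i (x i) ∂(Measure.pi μ) = ∏ i, ∫⁻ x, f i x ∂(μ i) := by
  induction n with
  | zero => simp
  | succ n ih =>
    calc
      _ = ∫⁻ x : E 0 × ((i : Fin n) → E (Fin.succ i)),
            f 0 x.1 * ∏ i : Fin n, f (Fin.succ i) (x.2 i)
            ∂((μ 0).prod (Measure.pi (fun i ↦ μ i.succ))) := by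
        rw [← ((measurePreserving_piFinSuccAbove μ 0).symm).lintegral_comp_emb
          (MeasurableEquiv.measurableEmbedding _)]
        refine lintegral_congr fun x => ?_
        rw [Fin.prod_univ_succ]
        rfl
      _ = (∫⁻ x, f 0 x ∂μ 0)
            * ∏ i : Fin n, ∫⁻ (x : E (Fin.succ i)), f (Fin.succ i) x ∂(μ i.succ) := by
        rw [← ih _ _ fun i => hf i.succ]
        have hm : Measurable fun y : (i : Fin n) → E i.succ => ∏ i, f i.succ (y i) :=
          Finset.measurable_prod _ fun i _ => (hf i.succ).comp (measurable_pi_apply i)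
        exact lintegral_prod_mul (hf 0).aemeasurable hm.aemeasurable
      _ = ∏ i, ∫⁻ x, f i x ∂(μ i) := by rw [Fin.prod_univ_succ]

theorem lintegral_fintype_prod_eq_prod {ι : Type*} [Fintype ι] {E : ι → Type*}
    {mE : ∀ i, MeasurableSpace (E i)} (μ : (i : ι) → Measure (E i)) [∀ i, SigmaFinite (μ i)]
    (f : (i : ι) → E i → ℝ≥0∞) (hf : ∀ i, Measurable (f i)) :
    ∫⁻ x : (i : ι) → E i, ∏ i, f i (x i) ∂(Measure.pi μ) = ∏ i, ∫⁻ x, f i x ∂(μ i) := by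
  let e := (Fintype.equivFin ι).symm
  rw [← (measurePreserving_piCongrLeft μ e).lintegral_comp_emb
    (MeasurableEquiv.measurableEmbedding _)]
  simp_rw [← e.prod_comp, MeasurableEquiv.coe_piCongrLeft, Equiv.piCongrLeft_apply_apply]
  exact lintegral_fin_prod_eq_prod (fun i => μ (e i)) (fun i => f (e i)) fun i => hf (e i)

theorem pi_withDensity {ι : Type*} [Fintype ι] {E : ι → Type*}
    {mE : ∀ i, MeasurableSpace (E i)} (μ : (i : ι) → Measure (E i)) [∀ i, SigmaFinite (μ i)]
    (f : (i : ι) → E i → ℝ≥0∞) (hf : ∀ i, Measurable (f i))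
    [∀ i, SigmaFinite ((μ i).withDensity (f i))] :
    Measure.pi (fun i => (μ i).withDensity (f i))
      = (Measure.pi μ).withDensity (fun x => ∏ i, f i (x i)) := by
  classical
  refine Measure.pi_eq fun s hs => ?_
  rw [withDensity_apply _ (MeasurableSet.univ_pi hs),
    ← lintegral_indicator (MeasurableSet.univ_pi hs)]
  have h1 : ∀ x : (i : ι) → E i, (Set.univ.pi s).indicator (fun x => ∏ i, f i (x i)) x
      = ∏ i, (s i).indicator (f i) (x i) := by
    intro x
    by_cases hx : x ∈ Set.univ.pi s
    · rw [Set.indicator_of_mem hx]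
      exact Finset.prod_congr rfl fun i _ => (Set.indicator_of_mem (hx i trivial) _).symm
    · rw [Set.indicator_of_notMem hx]
      simp only [Set.mem_pi, Set.mem_univ, forall_const, not_forall] at hx
      obtain ⟨i, hi⟩ := hx
      exact (Finset.prod_eq_zero (Finset.mem_univ i) (Set.indicator_of_notMem hi _)).symm
  simp_rw [h1]
  rw [lintegral_fintype_prod_eq_prod μ _ fun i => (hf i).indicator (hs i)]
  refine Finset.prod_congr rfl fun i _ => ?_
  rw [lintegral_indicator (hs i), withDensity_apply _ (hs i)]

end PiDensity

section Radial

theorem lintegral_fun_norm_addHaar {E : Type*} [NormedAddCommGroup E] [NormedSpace ℝ E]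
    [FiniteDimensional ℝ E] [MeasurableSpace E] [BorelSpace E] [Nontrivial E]
    (μ : Measure E) [μ.IsAddHaarMeasure] (f : ℝ → ℝ≥0∞) (hf : Measurable f) :
    ∫⁻ x, f ‖x‖ ∂μ = μ.toSphere Set.univ *
      ∫⁻ y in Set.Ioi (0 : ℝ), ENNReal.ofReal (y ^ (Module.finrank ℝ E - 1)) * f y := by
  calc
    ∫⁻ x, f ‖x‖ ∂μ = ∫⁻ x : ({(0)}ᶜ : Set E), f (‖x.1‖) ∂(μ.comap (↑)) := by
      rw [lintegral_subtype_comap (measurableSet_singleton _).compl fun x ↦ f (‖x‖),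
        restrict_compl_singleton]
    _ = ∫⁻ x : (Metric.sphere (0 : E) 1) × Set.Ioi (0 : ℝ), f x.2
          ∂(μ.toSphere.prod (Measure.volumeIoiPow (Module.finrank ℝ E - 1))) := by
      rw [← μ.measurePreserving_homeomorphUnitSphereProd.lintegral_comp_emb
        (Homeomorph.measurableEmbedding _)]
      simp
    _ = μ.toSphere Set.univ *
        ∫⁻ y, f y ∂(Measure.volumeIoiPow (Module.finrank ℝ E - 1)) := by
      have := lintegral_prod_mul (μ := μ.toSphere)
        (ν := Measure.volumeIoiPow (Module.finrank ℝ E - 1)) (f := fun _ => 1)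
        (g := fun y => f y) aemeasurable_const (hf.comp measurable_subtype_coe).aemeasurable
      simpa using this
    _ = _ := by
      congr 1
      have := lintegral_withDensity_eq_lintegral_mul
        (Measure.comap Subtype.val volume : Measure (Set.Ioi (0 : ℝ)))
        (f := fun r => ENNReal.ofReal (r.1 ^ (Module.finrank ℝ E - 1))) (by fun_prop)
        (hf.comp measurable_subtype_coe)
      rw [Measure.volumeIoiPow, ← lintegral_subtype_comap measurableSet_Ioi]
      exact this

theorem prod_gaussianPDF {ι : Type*} [Fintype ι] (x : EuclideanSpace ℝ ι) :
    ∏ i, gaussianPDF 0 1 (x i) = ENNReal.ofReal ((√(2 * Real.pi))⁻¹ ^ Fintype.card ι)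
      * ENNReal.ofReal (Real.exp (-‖x‖ ^ 2 / 2)) := by
  simp only [gaussianPDF, gaussianPDFReal]
  rw [← ENNReal.ofReal_prod_of_nonneg fun i _ => by positivity,
    ← ENNReal.ofReal_mul (by positivity), Finset.prod_mul_distrib, ← Real.exp_sum]
  simp [EuclideanSpace.real_norm_sq_eq, Finset.sum_div, neg_div]

theorem stdGaussian_eq_withDensity {ι : Type*} [Fintype ι] :
    stdGaussian (EuclideanSpace ℝ ι) = volume.withDensity
      (fun x => ENNReal.ofReal ((√(2 * Real.pi))⁻¹ ^ Fintype.card ι)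
        * ENNReal.ofReal (Real.exp (-‖x‖ ^ 2 / 2))) := by
  have h0 : gaussianReal 0 1 = volume.withDensity (gaussianPDF 0 1) := by
    rw [gaussianReal_of_var_ne_zero _ one_ne_zero]
  have hs : SigmaFinite (volume.withDensity (gaussianPDF 0 1)) := by rw [← h0]; infer_instance
  rw [← map_pi_eq_stdGaussian, h0, pi_withDensity _ _ fun _ => measurable_gaussianPDF 0 1]
  ext s hs
  rw [Measure.map_apply (by fun_prop) hs, withDensity_apply _ (by measurability),
    withDensity_apply _ hs, ← (PiLp.volume_preserving_toLp ι).setLIntegral_comp_preimage hs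
      (by fun_prop)]
  refine lintegral_congr fun x => ?_
  exact prod_gaussianPDF (WithLp.toLp 2 x)

theorem exists_lintegral_norm_sq_stdGaussian (ι : Type*) [Fintype ι] [Nonempty ι] :
    ∃ C : ℝ≥0∞, ∀ f : ℝ → ℝ≥0∞, Measurable f →
      ∫⁻ x, f (‖x‖ ^ 2) ∂(stdGaussian (EuclideanSpace ℝ ι))
        = C * ∫⁻ t in Set.Ioi (0 : ℝ), ENNReal.ofReal
            (t ^ ((Fintype.card ι : ℝ) / 2 - 1) * Real.exp (-t / 2)) * f t := by
  set m := Fintype.card ι with hm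
  have hm1 : 1 ≤ m := Fintype.card_pos
  set c := ENNReal.ofReal ((√(2 * Real.pi))⁻¹ ^ m)
  refine ⟨c * ((volume : Measure (EuclideanSpace ℝ ι)).toSphere Set.univ
    * ENNReal.ofReal (1 / 2)), fun f hf => ?_⟩
  have hsub : ∫⁻ t in Set.Ioi (0 : ℝ), ENNReal.ofReal
            (t ^ ((m : ℝ) / 2 - 1) * Real.exp (-t / 2)) * f t
      = ∫⁻ y in Set.Ioi (0 : ℝ), ENNReal.ofReal |2 * y| * (ENNReal.ofReal
            ((y ^ 2) ^ ((m : ℝ) / 2 - 1) * Real.exp (-y ^ 2 / 2)) * f (y ^ 2)) := by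
    rw [← lintegral_image_eq_lintegral_abs_deriv_mul (f := fun y : ℝ => y ^ 2)
      (f' := fun y => 2 * y) (g := fun t => ENNReal.ofReal
            (t ^ ((m : ℝ) / 2 - 1) * Real.exp (-t / 2)) * f t) measurableSet_Ioi]
    · congr 2
      ext t
      refine ⟨fun ht => ⟨√t, Real.sqrt_pos.2 ht, Real.sq_sqrt (le_of_lt ht)⟩, ?_⟩
      rintro ⟨y, hy, rfl⟩
      exact pow_pos (Set.mem_Ioi.1 hy) 2
    · intro y _
      simpa using (hasDerivAt_pow 2 y).hasDerivWithinAt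
    · intro a ha b hb h
      exact (pow_left_inj₀ (Set.mem_Ioi.1 ha).le (Set.mem_Ioi.1 hb).le two_ne_zero).1 h
  rw [stdGaussian_eq_withDensity, lintegral_withDensity_eq_lintegral_mul _ (by fun_prop)
    (by fun_prop), hsub]
  simp only [Pi.mul_apply, mul_assoc]
  rw [lintegral_const_mul _ (by fun_prop),
    lintegral_fun_norm_addHaar volume
      (fun y => ENNReal.ofReal (Real.exp (-y ^ 2 / 2)) * f (y ^ 2)) (by fun_prop),
    ← lintegral_const_mul (ENNReal.ofReal (1 / 2)) (by fun_prop)]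
  congr 2
  refine setLIntegral_congr_fun measurableSet_Ioi fun y hy => ?_
  have hy' : 0 < y := hy
  simp only [finrank_euclideanSpace, ← hm]
  rw [← mul_assoc, ← mul_assoc, ← mul_assoc, ← ENNReal.ofReal_mul (by positivity),
    ← ENNReal.ofReal_mul (by positivity), ← ENNReal.ofReal_mul (by positivity)]
  congr 2
  rw [abs_of_pos (by positivity), ← Real.rpow_natCast y 2, ← Real.rpow_mul hy'.le,
    ← Real.rpow_natCast y (m - 1)]
  have : y ^ (((m - 1 : ℕ)) : ℝ) = y * y ^ (((2 : ℕ) : ℝ) * ((m : ℝ) / 2 - 1)) := by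
    nth_rewrite 2 [← Real.rpow_one y]
    rw [← Real.rpow_add hy']
    push_cast [Nat.cast_sub hm1]
    ring_nf
  rw [this]
  ring

end Radial

section Beta

theorem lintegral_Ioi_rpow_mul_exp {c ρ : ℝ} (hc : 0 < c) (hρ : 0 < ρ) :
    ∫⁻ y in Set.Ioi (0 : ℝ), ENNReal.ofReal (y ^ (c - 1) * Real.exp (-(ρ * y)))
      = ENNReal.ofReal (Real.Gamma c / ρ ^ c) := by
  have h1 : ∫⁻ y in Set.Ioi (0 : ℝ), gammaPDF c ρ y = 1 := by
    rw [← lintegral_gammaPDF_eq_one hc hρ, setLIntegral_congr Ioi_ae_eq_Ici,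
      ← lintegral_indicator measurableSet_Ici]
    refine lintegral_congr fun y => ?_
    by_cases hy : 0 ≤ y
    · exact Set.indicator_of_mem hy _
    · rw [Set.indicator_of_notMem (by simpa using hy), gammaPDF_of_neg (not_le.1 hy)]
  have hG := Real.Gamma_pos_of_pos hc
  have hp := Real.rpow_pos_of_pos hρ c
  calc
    _ = ∫⁻ y in Set.Ioi (0 : ℝ), ENNReal.ofReal (Real.Gamma c / ρ ^ c) * gammaPDF c ρ y := by
      refine setLIntegral_congr_fun measurableSet_Ioi fun y hy => ?_
      rw [gammaPDF_of_nonneg (Set.mem_Ioi.1 hy).le, ← ENNReal.ofReal_mul (by positivity)]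
      congr 1
      field_simp
    _ = _ := by
      rw [lintegral_const_mul _ (by unfold gammaPDF; exact (measurable_gammaPDFReal c ρ).ennreal_ofReal),
        h1, mul_one]

theorem lintegral_gamma_weight_odds (a y : ℝ) (hy : 0 < y) (g : ℝ → ℝ≥0∞) :
    ∫⁻ x in Set.Ioi (0 : ℝ), ENNReal.ofReal (x ^ (a - 1) * Real.exp (-x / 2)) * g (x / (x + y))
      = ∫⁻ t in Set.Ioo (0 : ℝ) 1, ENNReal.ofReal |y / (1 - t) ^ 2|
          * (ENNReal.ofReal ((y * t / (1 - t)) ^ (a - 1) * Real.exp (-(y * t / (1 - t)) / 2))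
            * g t) := by
  have himg : (fun t : ℝ => y * t / (1 - t)) '' Set.Ioo 0 1 = Set.Ioi 0 := by
    ext x
    constructor
    · rintro ⟨t, ht, rfl⟩
      have := ht.1
      have := sub_pos.2 ht.2
      exact Set.mem_Ioi.2 (by positivity)
    · intro hx
      have hx : 0 < x := hx
      refine ⟨x / (x + y), ⟨by positivity, by rw [div_lt_one (by positivity)]; linarith⟩, ?_⟩
      have : 1 - x / (x + y) = y / (x + y) := by field_simp; ring
      simp only [this]
      field_simp
  have hder : ∀ t ∈ Set.Ioo (0 : ℝ) 1,
      HasDerivWithinAt (fun t : ℝ => y * t / (1 - t)) (y / (1 - t) ^ 2) (Set.Ioo 0 1) t := by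
    intro t ht
    have h1 : (1 - t) ≠ 0 := (sub_pos.2 ht.2).ne'
    have := (((hasDerivAt_id t).const_mul y).div ((hasDerivAt_id t).const_sub 1) h1)
    refine (this.congr_deriv ?_).hasDerivWithinAt
    simp only [id]
    congr 1
    ring
  have hinj : Set.InjOn (fun t : ℝ => y * t / (1 - t)) (Set.Ioo 0 1) := by
    intro s hs t ht h
    have h1 : (1 - t) ≠ 0 := (sub_pos.2 ht.2).ne'
    have h2 : (1 - s) ≠ 0 := (sub_pos.2 hs.2).ne'
    simp only at h
    rw [div_eq_div_iff h2 h1] at h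
    have : y * (s - t) = 0 := by linarith
    rcases mul_eq_zero.1 this with h | h
    · exact absurd h hy.ne'
    · linarith
  rw [← himg, lintegral_image_eq_lintegral_abs_deriv_mul measurableSet_Ioo hder hinj]
  refine setLIntegral_congr_fun measurableSet_Ioo fun t ht => ?_
  have h1 : (1 - t) ≠ 0 := (sub_pos.2 ht.2).ne'
  have : y * t / (1 - t) / (y * t / (1 - t) + y) = t := by
    have : y * t / (1 - t) + y = y / (1 - t) := by field_simp; ring
    rw [this]
    field_simp
  simp only [this]

theorem lintegral_gamma_weights_ratio {a b : ℝ} (ha : 0 < a) (hb : 0 < b)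
    (g : ℝ → ℝ≥0∞) (hg : Measurable g) :
    ∫⁻ y in Set.Ioi (0 : ℝ), ENNReal.ofReal (y ^ (b - 1) * Real.exp (-y / 2))
        * ∫⁻ x in Set.Ioi (0 : ℝ), ENNReal.ofReal (x ^ (a - 1) * Real.exp (-x / 2))
          * g (x / (x + y))
      = ENNReal.ofReal (2 ^ (a + b) * Real.Gamma (a + b)) *
        ∫⁻ t in Set.Ioo (0 : ℝ) 1, ENNReal.ofReal (t ^ (a - 1) * (1 - t) ^ (b - 1)) * g t := by
  calc
    _ = ∫⁻ y in Set.Ioi (0 : ℝ), ∫⁻ t in Set.Ioo (0 : ℝ) 1,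
          ENNReal.ofReal (y ^ (b - 1) * Real.exp (-y / 2)) * (ENNReal.ofReal |y / (1 - t) ^ 2|
          * (ENNReal.ofReal ((y * t / (1 - t)) ^ (a - 1) * Real.exp (-(y * t / (1 - t)) / 2))
            * g t)) := by
      refine setLIntegral_congr_fun measurableSet_Ioi fun y hy => ?_
      rw [lintegral_gamma_weight_odds a y hy g, lintegral_const_mul _ (by fun_prop)]
    _ = ∫⁻ t in Set.Ioo (0 : ℝ) 1, ∫⁻ y in Set.Ioi (0 : ℝ),
          ENNReal.ofReal (y ^ (b - 1) * Real.exp (-y / 2)) * (ENNReal.ofReal |y / (1 - t) ^ 2|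
          * (ENNReal.ofReal ((y * t / (1 - t)) ^ (a - 1) * Real.exp (-(y * t / (1 - t)) / 2))
            * g t)) := by
      refine lintegral_lintegral_swap ?_
      exact Measurable.aemeasurable (by unfold Function.uncurry; fun_prop)
    _ = ∫⁻ t in Set.Ioo (0 : ℝ) 1, ENNReal.ofReal (2 ^ (a + b) * Real.Gamma (a + b)) *
          (ENNReal.ofReal (t ^ (a - 1) * (1 - t) ^ (b - 1)) * g t) := by
      refine setLIntegral_congr_fun measurableSet_Ioo fun t ht => ?_
      have ht0 : 0 < t := ht.1
      have ht1 : 0 < 1 - t := sub_pos.2 ht.2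
      have hG := Real.Gamma_pos_of_pos (add_pos ha hb)
      have hρ : 0 < (2 * (1 - t))⁻¹ := by positivity
      have key : ∀ y ∈ Set.Ioi (0 : ℝ),
          ENNReal.ofReal (y ^ (b - 1) * Real.exp (-y / 2)) * (ENNReal.ofReal |y / (1 - t) ^ 2|
          * (ENNReal.ofReal ((y * t / (1 - t)) ^ (a - 1) * Real.exp (-(y * t / (1 - t)) / 2))
            * g t))
          = ENNReal.ofReal (t ^ (a - 1) * (1 - t) ^ (-1 - a)) * g t *
            ENNReal.ofReal (y ^ (a + b - 1) * Real.exp (-((2 * (1 - t))⁻¹ * y))) := by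
        intro y hy
        have hy : 0 < y := hy
        rw [mul_right_comm, ← mul_assoc, ← mul_assoc, ← ENNReal.ofReal_mul (by positivity),
          ← ENNReal.ofReal_mul (by positivity), ← ENNReal.ofReal_mul (by positivity)]
        congr 2
        rw [abs_of_pos (by positivity), Real.div_rpow (by positivity) ht1.le,
          Real.mul_rpow hy.le ht0.le]
        have e1 : Real.exp (-((2 * (1 - t))⁻¹ * y))
            = Real.exp (-y / 2) * Real.exp (-(y * t / (1 - t)) / 2) := by
          rw [← Real.exp_add]
          congr 1
          field_simp
          ring
        have e2 : y ^ (a + b - 1) = y ^ (b - 1) * y * y ^ (a - 1) := by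
          nth_rewrite 3 [← Real.rpow_one y]
          rw [← Real.rpow_add hy, ← Real.rpow_add hy]
          ring_nf
        have e3 : (1 - t) ^ (-1 - a) = ((1 - t) ^ 2)⁻¹ * ((1 - t) ^ (a - 1))⁻¹ := by
          rw [← Real.rpow_natCast, ← Real.rpow_neg ht1.le, ← Real.rpow_neg ht1.le,
            ← Real.rpow_add ht1]
          push_cast
          ring_nf
        rw [e1, e2, e3]
        ring
      rw [setLIntegral_congr_fun measurableSet_Ioi key, lintegral_const_mul _ (by fun_prop),
        lintegral_Ioi_rpow_mul_exp (add_pos ha hb) hρ, mul_right_comm,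
        ← mul_assoc, ← ENNReal.ofReal_mul (by positivity), ← ENNReal.ofReal_mul (by positivity)]
      congr 2
      rw [Real.inv_rpow (by positivity), Real.mul_rpow (by positivity) ht1.le]
      have e4 : (1 - t) ^ (b - 1) = (1 - t) ^ (-1 - a) * (1 - t) ^ (a + b) := by
        rw [← Real.rpow_add ht1]
        ring_nf
      rw [e4]
      field_simp
    _ = _ := lintegral_const_mul _ (by fun_prop)

end Beta

section BetaLaw

theorem exists_lintegral_sum_sq_pi_gaussian (ι : Type*) [Fintype ι] [Nonempty ι] :
    ∃ C : ℝ≥0∞, ∀ f : ℝ → ℝ≥0∞, Measurable f →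
      ∫⁻ x : ι → ℝ, f (∑ i, x i ^ 2) ∂(Measure.pi fun _ => gaussianReal 0 1)
        = C * ∫⁻ t in Set.Ioi (0 : ℝ), ENNReal.ofReal
            (t ^ ((Fintype.card ι : ℝ) / 2 - 1) * Real.exp (-t / 2)) * f t := by
  obtain ⟨C, hC⟩ := exists_lintegral_norm_sq_stdGaussian ι
  refine ⟨C, fun f hf => ?_⟩
  rw [← hC f hf, ← map_pi_eq_stdGaussian, lintegral_map (by fun_prop) (by fun_prop)]
  simp [EuclideanSpace.real_norm_sq_eq]

theorem exists_lintegral_sum_sq_ratio_pi_gaussian {ι : Type*} [Fintype ι] (p : ι → Prop)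
    [DecidablePred p] [Nonempty {i // p i}] [Nonempty {i // ¬ p i}] :
    ∃ K : ℝ≥0∞, ∀ g : ℝ → ℝ≥0∞, Measurable g →
      ∫⁻ x : ι → ℝ, g ((∑ i : {i // p i}, x i ^ 2) / ∑ i, x i ^ 2)
          ∂(Measure.pi fun _ => gaussianReal 0 1)
        = K * ∫⁻ t in Set.Ioo (0 : ℝ) 1, ENNReal.ofReal
            (t ^ ((Fintype.card {i // p i} : ℝ) / 2 - 1)
              * (1 - t) ^ ((Fintype.card {i // ¬ p i} : ℝ) / 2 - 1)) * g t := by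
  obtain ⟨C, hC⟩ := exists_lintegral_sum_sq_pi_gaussian {i // p i}
  obtain ⟨D, hD⟩ := exists_lintegral_sum_sq_pi_gaussian {i // ¬ p i}
  set a := (Fintype.card {i // p i} : ℝ) / 2 with ha
  set b := (Fintype.card {i // ¬ p i} : ℝ) / 2 with hb
  have ha0 : 0 < a := by rw [ha]; have := Fintype.card_pos (α := {i // p i}); positivity
  have hb0 : 0 < b := by rw [hb]; have := Fintype.card_pos (α := {i // ¬ p i}); positivity
  refine ⟨D * (C * ENNReal.ofReal (2 ^ (a + b) * Real.Gamma (a + b))), fun g hg => ?_⟩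
  have hsplit := (measurePreserving_piEquivPiSubtypeProd
    (fun _ : ι => gaussianReal 0 1) p).lintegral_comp
    (f := fun q => g ((∑ i, q.1 i ^ 2) / (∑ i, q.1 i ^ 2 + ∑ i, q.2 i ^ 2))) (by fun_prop)
  calc
    _ = ∫⁻ q : ({i // p i} → ℝ) × ({i // ¬ p i} → ℝ),
          g ((∑ i, q.1 i ^ 2) / (∑ i, q.1 i ^ 2 + ∑ i, q.2 i ^ 2))
          ∂((Measure.pi fun _ => gaussianReal 0 1).prod (Measure.pi fun _ => gaussianReal 0 1)) := by
      rw [← hsplit]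
      refine lintegral_congr fun x => ?_
      have := Fintype.sum_subtype_add_sum_subtype p fun i => x i ^ 2
      rw [← this]
      rfl
    _ = ∫⁻ y : ({i // ¬ p i} → ℝ), (C * ∫⁻ u in Set.Ioi (0 : ℝ), ENNReal.ofReal
            (u ^ (a - 1) * Real.exp (-u / 2)) * g (u / (u + ∑ i, y i ^ 2)))
          ∂(Measure.pi fun _ => gaussianReal 0 1) := by
      rw [lintegral_prod_symm' _ (by fun_prop)]
      refine lintegral_congr fun y => ?_
      exact hC (fun u => g (u / (u + ∑ i, y i ^ 2))) (by fun_prop)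
    _ = D * ∫⁻ v in Set.Ioi (0 : ℝ), ENNReal.ofReal (v ^ (b - 1) * Real.exp (-v / 2)) *
          (C * ∫⁻ u in Set.Ioi (0 : ℝ), ENNReal.ofReal
            (u ^ (a - 1) * Real.exp (-u / 2)) * g (u / (u + v))) := by
      refine hD (fun v => C * ∫⁻ u in Set.Ioi (0 : ℝ), ENNReal.ofReal
            (u ^ (a - 1) * Real.exp (-u / 2)) * g (u / (u + v))) ?_
      refine Measurable.const_mul ?_ _
      exact Measurable.lintegral_prod_right' (f := fun q : ℝ × ℝ => ENNReal.ofReal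
            (q.2 ^ (a - 1) * Real.exp (-q.2 / 2)) * g (q.2 / (q.2 + q.1))) (by fun_prop)
    _ = _ := by
      simp_rw [mul_left_comm _ C]
      rw [lintegral_const_mul, lintegral_gamma_weights_ratio ha0 hb0 g hg]
      · ring
      refine Measurable.mul (by fun_prop) ?_
      exact Measurable.lintegral_prod_right' (f := fun q : ℝ × ℝ => ENNReal.ofReal
            (q.2 ^ (a - 1) * Real.exp (-q.2 / 2)) * g (q.2 / (q.2 + q.1))) (by fun_prop)

theorem mul_lintegral_beta_weight_Ioo {a b α : ℝ} (hα : α ∈ Set.Ioo (0 : ℝ) 1) {K : ℝ≥0∞}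
    (hK : K * ∫⁻ t in Set.Ioo (0 : ℝ) 1, ENNReal.ofReal (t ^ (a - 1) * (1 - t) ^ (b - 1)) = 1) :
    K * ∫⁻ t in Set.Ioo α 1, ENNReal.ofReal (t ^ (a - 1) * (1 - t) ^ (b - 1))
      = ENNReal.ofReal (1 - regIncBeta a b α) := by
  set w : ℝ → ℝ := fun t => t ^ (a - 1) * (1 - t) ^ (b - 1) with hw
  have hwm : Measurable w := by fun_prop
  set L := ∫⁻ t in Set.Ioo (0 : ℝ) 1, ENNReal.ofReal (w t) with hL
  have hw0 : ∀ t ∈ Set.Ioo (0 : ℝ) 1, 0 ≤ w t := fun t ht =>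
    mul_nonneg (Real.rpow_nonneg ht.1.le _) (Real.rpow_nonneg (sub_pos.2 ht.2).le _)
  have hK0 : K ≠ 0 := by rintro rfl; simp at hK
  have hLtop : L ≠ ∞ := by
    intro h
    rw [h, ENNReal.mul_top hK0] at hK
    simp at hK
  have hL0 : L ≠ 0 := by intro h; rw [h] at hK; simp at hK
  have hint : IntegrableOn w (Set.Ioo 0 1) := by
    refine ⟨hwm.aestronglyMeasurable, ?_⟩
    rw [hasFiniteIntegral_iff_ofReal]
    · exact hLtop.lt_top
    · exact (ae_restrict_iff' measurableSet_Ioo).2 (Filter.Eventually.of_forall hw0)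
  have hii : IntervalIntegrable w volume 0 1 := by
    rwa [intervalIntegrable_iff_integrableOn_Ioo_of_le zero_le_one]
  have hi : ∀ s t : ℝ, 0 ≤ s → s ≤ t → t ≤ 1 → ENNReal.ofReal (∫ x in s..t, w x)
      = ∫⁻ x in Set.Ioo s t, ENNReal.ofReal (w x) := by
    intro s t hs hst ht
    have hsub : Set.Ioo s t ⊆ Set.Ioo 0 1 := Set.Ioo_subset_Ioo hs ht
    rw [intervalIntegral.integral_of_le hst, integral_Ioc_eq_integral_Ioo,
      ofReal_integral_eq_lintegral_ofReal (hint.mono_set hsub)]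
    exact (ae_restrict_iff' measurableSet_Ioo).2
      (Filter.Eventually.of_forall fun x hx => hw0 x (hsub hx))
  have hadd : (∫ x in (0 : ℝ)..α, w x) + ∫ x in α..1, w x = ∫ x in (0 : ℝ)..1, w x := by
    refine intervalIntegral.integral_add_adjacent_intervals (hii.mono_set ?_) (hii.mono_set ?_)
    · rw [Set.uIcc_of_le hα.1.le, Set.uIcc_of_le zero_le_one]
      exact Set.Icc_subset_Icc le_rfl hα.2.le
    · rw [Set.uIcc_of_le hα.2.le, Set.uIcc_of_le zero_le_one]
      exact Set.Icc_subset_Icc hα.1.le le_rfl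
  have hLB : ENNReal.ofReal (∫ x in (0 : ℝ)..1, w x) = L := hi 0 1 le_rfl zero_le_one le_rfl
  have hB : 0 < ∫ x in (0 : ℝ)..1, w x := by
    rw [← ENNReal.ofReal_pos, hLB]
    exact pos_iff_ne_zero.2 hL0
  have hreg : 1 - regIncBeta a b α = (∫ x in α..1, w x) / ∫ x in (0 : ℝ)..1, w x := by
    unfold regIncBeta
    rw [eq_div_iff hB.ne', sub_mul, div_mul_cancel₀ _ hB.ne', one_mul]
    linarith
  rw [hreg, ENNReal.ofReal_div_of_pos hB, hLB, hi α 1 hα.1.le hα.2.le le_rfl,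
    ENNReal.eq_inv_of_mul_eq_one_left hK, ENNReal.div_eq_inv_mul]

theorem pi_gaussian_sum_sq_gt {ι : Type*} [Fintype ι] (p : ι → Prop)
    [DecidablePred p] [Nonempty {i // p i}] [Nonempty {i // ¬ p i}] {α : ℝ}
    (hα : α ∈ Set.Ioo (0 : ℝ) 1) :
    (Measure.pi fun _ : ι => gaussianReal 0 1)
        {x | α * ∑ i, x i ^ 2 < ∑ i : {i // p i}, x i ^ 2}
      ≤ ENNReal.ofReal (1 - regIncBeta ((Fintype.card {i // p i} : ℝ) / 2)
          ((Fintype.card {i // ¬ p i} : ℝ) / 2) α) := by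
  obtain ⟨K, hK⟩ := exists_lintegral_sum_sq_ratio_pi_gaussian p
  have h1 := hK (fun _ => 1) measurable_const
  simp only [lintegral_const, measure_univ, mul_one] at h1
  rw [← mul_lintegral_beta_weight_Ioo hα h1.symm]
  have h2 := hK ((Set.Ioi α).indicator 1) (measurable_one.indicator measurableSet_Ioi)
  have h3 : ∀ t, ENNReal.ofReal
            (t ^ ((Fintype.card {i // p i} : ℝ) / 2 - 1)
              * (1 - t) ^ ((Fintype.card {i // ¬ p i} : ℝ) / 2 - 1))
              * (Set.Ioi α).indicator 1 t
      = (Set.Ioi α).indicator (fun t => ENNReal.ofReal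
            (t ^ ((Fintype.card {i // p i} : ℝ) / 2 - 1)
              * (1 - t) ^ ((Fintype.card {i // ¬ p i} : ℝ) / 2 - 1))) t := by
    intro t
    by_cases ht : t ∈ Set.Ioi α <;> simp [ht]
  simp_rw [h3] at h2
  rw [setLIntegral_indicator measurableSet_Ioi, Set.Ioi_inter_Ioo, max_eq_left hα.1.le] at h2
  rw [← h2, ← lintegral_indicator_one]
  · refine lintegral_mono fun x => ?_
    by_cases hx : α * ∑ i, x i ^ 2 < ∑ i : {i // p i}, x i ^ 2
    · have hle : ∑ i : {i // p i}, x i ^ 2 ≤ ∑ i, x i ^ 2 := by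
        rw [← Fintype.sum_subtype_add_sum_subtype p fun i => x i ^ 2]
        exact le_add_of_nonneg_right (Finset.sum_nonneg fun i _ => sq_nonneg _)
      have hpos : 0 < ∑ i, x i ^ 2 := by
        have h0 : 0 ≤ ∑ i, x i ^ 2 := Finset.sum_nonneg fun i _ => sq_nonneg _
        refine h0.lt_of_ne fun h => ?_
        rw [← h] at hx hle
        linarith
      have : (∑ i : {i // p i}, x i ^ 2) / ∑ i, x i ^ 2 ∈ Set.Ioi α :=
        (lt_div_iff₀ hpos).2 hx
      simp [this, hx]
    · simp [hx]
  · exact measurableSet_lt (by fun_prop) (by fun_prop)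

end BetaLaw

section RandomSubspace

open scoped RealInnerProductSpace

/-- Families `Z` whose span contains a direction `w` with `cos² ∠(w, u) > α`. -/
def alignedFamilies {d r : ℕ} (α : ℝ) (u : EuclideanSpace ℝ (Fin d)) :
    Set (Fin r → EuclideanSpace ℝ (Fin d)) :=
  {Z | ∃ c : Fin r → ℝ, α * ‖u‖ ^ 2 * ‖∑ l, c l • Z l‖ ^ 2 < ⟪∑ l, c l • Z l, u⟫ ^ 2}

variable {d r : ℕ}

theorem isOpen_setOf_mem_alignedFamilies (α : ℝ) :
    IsOpen {q : (Fin r → EuclideanSpace ℝ (Fin d)) × EuclideanSpace ℝ (Fin d) |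
      q.1 ∈ alignedFamilies α q.2} := by
  have : {q : (Fin r → EuclideanSpace ℝ (Fin d)) × EuclideanSpace ℝ (Fin d) |
      q.1 ∈ alignedFamilies α q.2} = ⋃ c : Fin r → ℝ, {q | α * ‖q.2‖ ^ 2 *
        ‖∑ l, c l • q.1 l‖ ^ 2 < ⟪∑ l, c l • q.1 l, q.2⟫ ^ 2} := by
    ext
    simp [alignedFamilies]
  rw [this]
  refine isOpen_iUnion fun c => isOpen_lt ?_ ?_ <;> fun_prop

theorem alignedFamilies_smul (α : ℝ) (u : EuclideanSpace ℝ (Fin d)) {t : ℝ} (ht : t ≠ 0) :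
    (alignedFamilies α (t • u) : Set (Fin r → EuclideanSpace ℝ (Fin d)))
      = alignedFamilies α u := by
  ext Z
  refine exists_congr fun c => ?_
  rw [norm_smul, inner_smul_right, Real.norm_eq_abs, mul_pow, mul_pow, sq_abs, mul_left_comm,
    mul_assoc]
  exact mul_lt_mul_iff_right₀ (by positivity)

theorem measure_alignedFamilies_map (α : ℝ) (u : EuclideanSpace ℝ (Fin d))
    (R : EuclideanSpace ℝ (Fin d) ≃ₗᵢ[ℝ] EuclideanSpace ℝ (Fin d)) :
    (Measure.pi fun _ : Fin r => stdGaussian (EuclideanSpace ℝ (Fin d)))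
        (alignedFamilies α (R u))
      = (Measure.pi fun _ : Fin r => stdGaussian (EuclideanSpace ℝ (Fin d)))
        (alignedFamilies α u) := by
  have hR : MeasurePreserving R (stdGaussian (EuclideanSpace ℝ (Fin d)))
      (stdGaussian (EuclideanSpace ℝ (Fin d))) :=
    ⟨R.continuous.measurable, stdGaussian_map R⟩
  have hpi := measurePreserving_pi (fun _ : Fin r => stdGaussian (EuclideanSpace ℝ (Fin d)))
    (fun _ => stdGaussian (EuclideanSpace ℝ (Fin d))) (fun _ => hR)
  have hm : MeasurableSet
      (alignedFamilies α (R u) : Set (Fin r → EuclideanSpace ℝ (Fin d))) :=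
    ((isOpen_setOf_mem_alignedFamilies α).preimage
      (Continuous.prodMk continuous_id continuous_const)).measurableSet
  rw [← hpi.measure_preimage hm.nullMeasurableSet]
  congr 1
  ext Z
  refine exists_congr fun c => ?_
  have : ∑ l, c l • R (Z l) = R (∑ l, c l • Z l) := by simp
  rw [this, R.inner_map_map, R.norm_map, R.norm_map]

theorem measure_alignedFamilies_congr (α : ℝ) {u v : EuclideanSpace ℝ (Fin d)} (hu : u ≠ 0)
    (hv : v ≠ 0) :
    (Measure.pi fun _ : Fin r => stdGaussian (EuclideanSpace ℝ (Fin d))) (alignedFamilies α u)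
      = (Measure.pi fun _ : Fin r => stdGaussian (EuclideanSpace ℝ (Fin d)))
        (alignedFamilies α v) := by
  have hv' := norm_pos_iff.2 hv
  have hu' := norm_pos_iff.2 hu
  have hn : ‖(‖v‖ / ‖u‖) • u‖ = ‖v‖ := by
    rw [norm_smul, Real.norm_of_nonneg (by positivity), div_mul_cancel₀ _ hu'.ne']
  rw [← alignedFamilies_smul α u (t := ‖v‖ / ‖u‖) (by positivity),
    ← measure_alignedFamilies_map α _ (Submodule.reflection (ℝ ∙ ((‖v‖ / ‖u‖) • u - v))ᗮ),
    Submodule.reflection_sub hn]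

theorem stdGaussian_aligned_le (hr : 1 ≤ r) (hrd : r < d) {α : ℝ} (hα : α ∈ Set.Ioo (0 : ℝ) 1)
    (Z : Fin r → EuclideanSpace ℝ (Fin d)) :
    stdGaussian (EuclideanSpace ℝ (Fin d)) {g | Z ∈ alignedFamilies α g}
      ≤ ENNReal.ofReal (1 - regIncBeta ((r : ℝ) / 2) (((d : ℝ) - r) / 2) α) := by
  let p : Fin d → Prop := fun i => (i : ℕ) < r
  have : Nonempty {i // p i} := ⟨⟨⟨0, by omega⟩, by simp only [p]; omega⟩⟩
  have : Nonempty {i // ¬ p i} := ⟨⟨⟨r, hrd⟩, by simp only [p]; omega⟩⟩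
  have hcard : Fintype.card {i // p i} = r := by
    simp only [p]
    rw [Fintype.card_congr (Fin.castLEquiv hrd.le).symm, Fintype.card_fin]
  have hcard' : ((Fintype.card {i // ¬ p i} : ℕ) : ℝ) = d - r := by
    rw [Fintype.card_subtype_compl, hcard, Fintype.card_fin, Nat.cast_sub hrd.le]
  let f : Fin d → EuclideanSpace ℝ (Fin d) := fun i =>
    if h : (i : ℕ) < r then Z ⟨i, h⟩ else 0
  let b := InnerProductSpace.gramSchmidtOrthonormalBasis (𝕜 := ℝ) (finrank_euclideanSpace) f
  have hb : ∀ (c : Fin r → ℝ) (j : Fin d), ¬ p j → ⟪b j, ∑ l, c l • Z l⟫ = 0 := by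
    intro c j hj
    rw [inner_sum]
    refine Finset.sum_eq_zero fun l _ => ?_
    have hl : f ⟨l, l.2.trans hrd⟩ = Z l := by simp [f]
    rw [inner_smul_right, ← hl]
    refine mul_eq_zero_of_right _ (InnerProductSpace.gramSchmidtOrthonormalBasis_inv_triangular _ f ?_)
    rw [Fin.lt_def]
    exact l.2.trans_le (not_lt.1 hj)
  have hmp : MeasurePreserving (fun g i => b.repr g i) (stdGaussian (EuclideanSpace ℝ (Fin d)))
      (Measure.pi fun _ : Fin d => gaussianReal 0 1) := by
    refine ⟨by fun_prop, ?_⟩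
    have h1 := stdGaussian_map b.repr
    have h2 := congrArg (Measure.map (WithLp.ofLp (p := 2))) h1
    rw [Measure.map_map (by fun_prop) (by fun_prop)] at h2
    refine h2.trans ?_
    rw [← map_pi_eq_stdGaussian (ι := Fin d), Measure.map_map (by fun_prop) (by fun_prop)]
    exact Measure.map_id
  have hmeas : MeasurableSet {x : Fin d → ℝ | α * ∑ i, x i ^ 2 < ∑ i : {i // p i}, x i ^ 2} :=
    measurableSet_lt (by fun_prop) (by fun_prop)
  have hle := pi_gaussian_sum_sq_gt p hα
  rw [hcard, hcard', ← hmp.measure_preimage hmeas.nullMeasurableSet] at hle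
  refine (measure_mono ?_).trans hle
  rintro g ⟨c, hc⟩
  set w := ∑ l, c l • Z l with hw
  have hw2 : ‖w‖ ^ 2 = ∑ i : {i // p i}, (b.repr w i) ^ 2 := by
    rw [← b.repr.norm_map, EuclideanSpace.real_norm_sq_eq,
      ← Fintype.sum_subtype_add_sum_subtype p fun i => (b.repr w i) ^ 2, add_eq_left]
    refine Finset.sum_eq_zero fun i _ => ?_
    rw [b.repr_apply_apply, hb c i i.2]
    simp
  have hwg : ⟪w, g⟫ = ∑ i : {i // p i}, b.repr w i * b.repr g i := by
    rw [← b.repr.inner_map_map, PiLp.inner_apply,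
      ← Fintype.sum_subtype_add_sum_subtype p, add_eq_left.2]
    · simp [mul_comm]
    refine Finset.sum_eq_zero fun i _ => ?_
    rw [b.repr_apply_apply, hb c i i.2]
    simp
  have hg2 : ‖g‖ ^ 2 = ∑ i, (b.repr g i) ^ 2 := by
    rw [← b.repr.norm_map, EuclideanSpace.real_norm_sq_eq]
  have hcs : ⟪w, g⟫ ^ 2 ≤ ‖w‖ ^ 2 * ∑ i : {i // p i}, (b.repr g i) ^ 2 := by
    rw [hwg, hw2]
    exact Finset.sum_mul_sq_le_sq_mul_sq _ _ _
  have hlt := hc.trans_le hcs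
  have : ‖w‖ ^ 2 * (α * ‖g‖ ^ 2) < ‖w‖ ^ 2 * ∑ i : {i // p i}, (b.repr g i) ^ 2 := by
    linarith
  have := lt_of_mul_lt_mul_left this (sq_nonneg _)
  rwa [hg2] at this

theorem stdGaussian_singleton_zero (hd : 1 ≤ d) :
    stdGaussian (EuclideanSpace ℝ (Fin d)) {0} = 0 := by
  have : Nonempty (Fin d) := ⟨⟨0, hd⟩⟩
  rw [stdGaussian_eq_withDensity]
  exact withDensity_absolutelyContinuous _ _ (measure_singleton 0)

theorem measure_alignedFamilies_le (hr : 1 ≤ r) (hrd : r < d) {α : ℝ}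
    (hα : α ∈ Set.Ioo (0 : ℝ) 1) {u : EuclideanSpace ℝ (Fin d)} (hu : u ≠ 0) :
    (Measure.pi fun _ : Fin r => stdGaussian (EuclideanSpace ℝ (Fin d))) (alignedFamilies α u)
      ≤ ENNReal.ofReal (1 - regIncBeta ((r : ℝ) / 2) (((d : ℝ) - r) / 2) α) := by
  set ν := Measure.pi fun _ : Fin r => stdGaussian (EuclideanSpace ℝ (Fin d))
  set γ := stdGaussian (EuclideanSpace ℝ (Fin d))
  have hS : MeasurableSet {q : (Fin r → EuclideanSpace ℝ (Fin d)) × EuclideanSpace ℝ (Fin d) |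
      q.1 ∈ alignedFamilies α q.2} := (isOpen_setOf_mem_alignedFamilies α).measurableSet
  have hae : ∀ᵐ g ∂γ, g ≠ 0 := by
    rw [ae_iff]
    simpa using stdGaussian_singleton_zero (by omega)
  calc
    ν (alignedFamilies α u) = ∫⁻ _, ν (alignedFamilies α u) ∂γ := by simp
    _ = ∫⁻ g, ν (alignedFamilies α g) ∂γ :=
      lintegral_congr_ae (hae.mono fun g hg => measure_alignedFamilies_congr α hu hg)
    _ = (ν.prod γ) {q | q.1 ∈ alignedFamilies α q.2} := by
      rw [Measure.prod_apply_symm hS]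
      rfl
    _ = ∫⁻ Z, γ {g | Z ∈ alignedFamilies α g} ∂ν := by
      rw [Measure.prod_apply hS]
      rfl
    _ ≤ ∫⁻ _, ENNReal.ofReal (1 - regIncBeta ((r : ℝ) / 2) (((d : ℝ) - r) / 2) α) ∂ν :=
      lintegral_mono fun Z => stdGaussian_aligned_le hr hrd hα Z
    _ = _ := by simp

end RandomSubspace

section GaussianShift

theorem gaussianReal_eq_withDensity_exp (w : ℝ) :
    gaussianReal w 1 = (gaussianReal 0 1).withDensity
      (fun x => ENNReal.ofReal (Real.exp (w * x - w ^ 2 / 2))) := by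
  rw [gaussianReal_of_var_ne_zero _ one_ne_zero, gaussianReal_of_var_ne_zero _ one_ne_zero,
    ← withDensity_mul _ (measurable_gaussianPDF _ _) (by fun_prop)]
  congr 1
  ext x
  simp only [gaussianPDF, Pi.mul_apply, gaussianPDFReal]
  rw [← ENNReal.ofReal_mul (by positivity), mul_assoc (√_)⁻¹, ← Real.exp_add]
  congr 3
  push_cast
  ring

variable {ι : Type*} [Fintype ι]

theorem pi_gaussianReal_eq_withDensity_exp (w : ι → ℝ) :
    (Measure.pi fun i => gaussianReal (w i) 1) = (Measure.pi fun _ : ι => gaussianReal 0 1).withDensity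
      (fun x => ENNReal.ofReal (Real.exp (∑ i, w i * x i - (∑ i, w i ^ 2) / 2))) := by
  have (i : ι) : SigmaFinite ((gaussianReal 0 1).withDensity
      (fun x => ENNReal.ofReal (Real.exp (w i * x - w i ^ 2 / 2)))) := by
    rw [← gaussianReal_eq_withDensity_exp]
    infer_instance
  rw [funext fun i => gaussianReal_eq_withDensity_exp (w i), pi_withDensity _ _ fun i => by fun_prop]
  congr 1
  ext x
  rw [← ENNReal.ofReal_prod_of_nonneg fun i _ => (Real.exp_pos _).le, ← Real.exp_sum,
    Finset.sum_sub_distrib, Finset.sum_div]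

theorem map_add_pi_gaussianReal (w : ι → ℝ) :
    (Measure.pi fun _ : ι => gaussianReal 0 1).map (fun x i => x i + w i)
      = Measure.pi fun i => gaussianReal (w i) 1 := by
  have (i : ι) : SigmaFinite ((gaussianReal 0 1).map (· + w i)) := by
    rw [gaussianReal_map_add_const]
    infer_instance
  rw [Measure.pi_map_pi (f := fun i y => y + w i) fun i => by fun_prop]
  simp [gaussianReal_map_add_const]

theorem map_sum_mul_pi_gaussianReal (w : ι → ℝ) :
    (Measure.pi fun _ : ι => gaussianReal 0 1).map (fun x => ∑ i, w i * x i)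
      = gaussianReal 0 (∑ i, w i ^ 2).toNNReal := by
  let L : StrongDual ℝ (EuclideanSpace ℝ ι) := innerSL ℝ (WithLp.toLp 2 w)
  have hL : (fun x : ι → ℝ => ∑ i, w i * x i) = L ∘ WithLp.toLp 2 := by
    ext x
    simp [L, PiLp.inner_apply, mul_comm]
  rw [hL, ← Measure.map_map (by fun_prop) (by fun_prop), map_pi_eq_stdGaussian,
    IsGaussian.map_eq_gaussianReal, integral_strongDual_stdGaussian, variance_dual_stdGaussian]
  simp [L, innerSL_apply_norm, EuclideanSpace.real_norm_sq_eq]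

theorem gaussianReal_Ioi_eq {S : ℝ} (hS : 0 < S) (t : ℝ) :
    gaussianReal 0 S.toNNReal (Set.Ioi t) = ENNReal.ofReal (1 - Phi (t / √S)) := by
  have h : gaussianReal 0 S.toNNReal = (gaussianReal 0 1).map (√S * ·) := by
    rw [gaussianReal_map_const_mul]
    congr 1
    · simp
    · ext
      simp [Real.sq_sqrt hS.le, hS.le]
  rw [h, Measure.map_apply (by fun_prop) measurableSet_Ioi]
  have hpre : (√S * ·) ⁻¹' Set.Ioi t = (Set.Iic (t / √S))ᶜ := by
    ext x
    simp [div_lt_iff₀' (Real.sqrt_pos.2 hS)]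
  rw [hpre, prob_compl_eq_one_sub measurableSet_Iic, Phi,
    ENNReal.ofReal_sub _ ENNReal.toReal_nonneg, ENNReal.ofReal_toReal (measure_ne_top _ _),
    ENNReal.ofReal_one]

theorem pi_gaussianReal_shift_le (w : ι → ℝ) (hw : 0 < ∑ i, w i ^ 2) (ε : ℝ) {B : Set (ι → ℝ)}
    (hB : MeasurableSet B) :
    (Measure.pi fun _ : ι => gaussianReal 0 1) {x | (fun i => x i + w i) ∈ B}
      ≤ ENNReal.ofReal (Real.exp ε) * (Measure.pi fun _ : ι => gaussianReal 0 1) B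
        + ENNReal.ofReal (1 - Phi ((ε - (∑ i, w i ^ 2) / 2) / √(∑ i, w i ^ 2))) := by
  set S := ∑ i, w i ^ 2 with hS
  set ν := Measure.pi fun _ : ι => gaussianReal 0 1
  let G : Set (ι → ℝ) := {x | ∑ i, w i * x i - S / 2 ≤ ε}
  have hG : MeasurableSet G := measurableSet_le (by fun_prop) (by fun_prop)
  have hshift : Measurable fun (x : ι → ℝ) i => x i + w i := by fun_prop
  have hsplit : {x | (fun i => x i + w i) ∈ B}
      ⊆ (fun (x : ι → ℝ) i => x i + w i) ⁻¹' (B ∩ G) ∪ (fun (x : ι → ℝ) i => x i + w i) ⁻¹' Gᶜ := by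
    intro x hx
    by_cases h : (fun i => x i + w i) ∈ G
    · exact Or.inl ⟨hx, h⟩
    · exact Or.inr h
  refine (measure_mono hsplit).trans ((measure_union_le _ _).trans (add_le_add ?_ (le_of_eq ?_)))
  · rw [← Measure.map_apply hshift (hB.inter hG), map_add_pi_gaussianReal,
      pi_gaussianReal_eq_withDensity_exp, withDensity_apply _ (hB.inter hG)]
    calc
      _ ≤ ∫⁻ _ in B ∩ G, ENNReal.ofReal (Real.exp ε) ∂ν :=
        setLIntegral_mono measurable_const fun x hx =>
          ENNReal.ofReal_le_ofReal (Real.exp_le_exp.2 hx.2)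
      _ = ENNReal.ofReal (Real.exp ε) * ν (B ∩ G) := by simp
      _ ≤ _ := by gcongr; exact Set.inter_subset_left
  · rw [← gaussianReal_Ioi_eq hw, ← map_sum_mul_pi_gaussianReal,
      Measure.map_apply (by fun_prop) measurableSet_Ioi]
    congr 1
    ext x
    have : ∑ i, w i * (x i + w i) = ∑ i, w i * x i + S := by
      simp only [mul_add, Finset.sum_add_distrib, hS, sq]
    simp only [G, Set.mem_preimage, Set.mem_compl_iff, Set.mem_ofPred_eq, Set.mem_Ioi, not_le, this]
    constructor <;> intro h <;> linarith

theorem Phi_mono : Monotone Phi := fun _ _ h =>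
  ENNReal.toReal_mono (measure_ne_top _ _) (measure_mono (Set.Iic_subset_Iic.2 h))

theorem Phi_le_one (x : ℝ) : Phi x ≤ 1 :=
  ENNReal.toReal_le_of_le_ofReal zero_le_one (by simpa using prob_le_one)

theorem Phi_nonneg (x : ℝ) : 0 ≤ Phi x := ENNReal.toReal_nonneg

theorem div_sqrt_anti {ε S T : ℝ} (hε : 0 ≤ ε) (hS : 0 < S) (hST : S ≤ T) :
    (ε - T / 2) / √T ≤ (ε - S / 2) / √S := by
  have hs := Real.sqrt_pos.2 hS
  have ht := Real.sqrt_pos.2 (hS.trans_le hST)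
  have hle := Real.sqrt_le_sqrt hST
  rw [sub_div, sub_div, div_right_comm, div_right_comm S, Real.div_sqrt, Real.div_sqrt]
  have : ε / √T ≤ ε / √S := div_le_div_of_nonneg_left hε hs hle
  linarith

theorem pi_gaussianReal_shift_le_of_le (w : ι → ℝ) {T : ℝ} (hw : ∑ i, w i ^ 2 ≤ T)
    {ε : ℝ} (hε : 0 ≤ ε) {B : Set (ι → ℝ)} (hB : MeasurableSet B) :
    (Measure.pi fun _ : ι => gaussianReal 0 1) {x | (fun i => x i + w i) ∈ B}
      ≤ ENNReal.ofReal (Real.exp ε) * (Measure.pi fun _ : ι => gaussianReal 0 1) B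
        + ENNReal.ofReal (1 - Phi ((ε - T / 2) / √T)) := by
  have hnn : 0 ≤ ∑ i, w i ^ 2 := Finset.sum_nonneg fun i _ => sq_nonneg _
  rcases hnn.eq_or_lt with h0 | hpos
  · have hz (i : ι) : w i = 0 := by
      simpa using (Finset.sum_eq_zero_iff_of_nonneg fun i _ => sq_nonneg (w i)).1 h0.symm i
        (Finset.mem_univ i)
    simp only [hz, add_zero]
    refine le_add_right (le_mul_of_one_le_left' ?_)
    exact ENNReal.one_le_ofReal.2 (Real.one_le_exp hε)
  · refine (pi_gaussianReal_shift_le w hpos ε hB).trans ?_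
    gcongr
    exact Phi_mono (div_sqrt_anti hε hpos hw)

theorem measurePreserving_uncurry_pi {κ : Type*} [Fintype κ] {X : Type*} [MeasurableSpace X]
    (μ : Measure X) [SigmaFinite μ] :
    MeasurePreserving (fun (x : ι → κ → X) (p : ι × κ) => x p.1 p.2)
      (Measure.pi fun _ => Measure.pi fun _ => μ) (Measure.pi fun _ => μ) := by
  have hm : Measurable fun (x : ι → κ → X) (p : ι × κ) => x p.1 p.2 := by fun_prop
  refine ⟨hm, (Measure.pi_eq fun s hs => ?_).symm⟩
  have hpre : (fun (x : ι → κ → X) (p : ι × κ) => x p.1 p.2) ⁻¹' Set.univ.pi s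
      = Set.univ.pi fun i => Set.univ.pi fun k => s (i, k) := by
    ext
    simp
  rw [Measure.map_apply hm (MeasurableSet.univ_pi hs), hpre, Measure.pi_pi,
    Fintype.prod_prod_type]
  simp [Measure.pi_pi]

theorem pi_pi_gaussianReal_shift_le {κ : Type*} [Fintype κ] (w : ι → κ → ℝ) {T : ℝ}
    (hw : ∑ i, ∑ k, w i k ^ 2 ≤ T) {ε : ℝ} (hε : 0 ≤ ε) {B : Set (ι → κ → ℝ)}
    (hB : MeasurableSet B) :
    (Measure.pi fun _ : ι => Measure.pi fun _ : κ => gaussianReal 0 1)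
        {x | (fun i k => x i k + w i k) ∈ B}
      ≤ ENNReal.ofReal (Real.exp ε)
          * (Measure.pi fun _ : ι => Measure.pi fun _ : κ => gaussianReal 0 1) B
        + ENNReal.ofReal (1 - Phi ((ε - T / 2) / √T)) := by
  have hmp := measurePreserving_uncurry_pi (ι := ι) (κ := κ) (gaussianReal 0 1)
  let B' : Set (ι × κ → ℝ) := {y | (fun i k => y (i, k)) ∈ B}
  have hB' : MeasurableSet B' := hB.preimage (by fun_prop)
  have hB'' : MeasurableSet {y : ι × κ → ℝ | (fun p => y p + w p.1 p.2) ∈ B'} :=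
    hB'.preimage (by fun_prop)
  have := pi_gaussianReal_shift_le_of_le (fun p : ι × κ => w p.1 p.2) (T := T)
    (by rwa [Fintype.sum_prod_type]) hε hB'
  rwa [← hmp.measure_preimage hB'.nullMeasurableSet,
    ← hmp.measure_preimage hB''.nullMeasurableSet] at this

end GaussianShift

section Projection

open scoped RealInnerProductSpace

variable {d r n : ℕ}

theorem norm_sq_starProjection_le_of_notMem {α : ℝ}
    {u : EuclideanSpace ℝ (Fin d)} {Z : Fin r → EuclideanSpace ℝ (Fin d)}
    (hZ : Z ∉ alignedFamilies α u) (hα : 0 ≤ α) :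
    ‖(Submodule.span ℝ (Set.range Z)).starProjection u‖ ^ 2 ≤ α * ‖u‖ ^ 2 := by
  set W := Submodule.span ℝ (Set.range Z)
  have hmem : W.starProjection u ∈ W := W.starProjection_apply_mem u
  obtain ⟨c, hc⟩ := (Submodule.mem_span_range_iff_exists_fun ℝ).1 hmem
  have hin : ⟪W.starProjection u, u⟫ = ‖W.starProjection u‖ ^ 2 := by
    simpa using W.re_inner_starProjection_eq_normSq u
  have h : ⟪W.starProjection u, u⟫ ^ 2 ≤ α * ‖u‖ ^ 2 * ‖W.starProjection u‖ ^ 2 := by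
    rw [← hc]
    exact not_lt.1 fun h => hZ ⟨c, h⟩
  rw [hin, sq (‖W.starProjection u‖ ^ 2)] at h
  rcases (sq_nonneg ‖W.starProjection u‖).eq_or_lt with h0 | hpos
  · rw [← h0]
    positivity
  · exact le_of_mul_le_mul_right h hpos

/-- The `k`-th column of a matrix as a Euclidean vector. -/
noncomputable def euclideanCol (B : Matrix (Fin d) (Fin n) ℝ) (k : Fin n) :
    EuclideanSpace ℝ (Fin d) :=
  WithLp.toLp 2 fun i => B i k

theorem inner_euclideanCol (B : Matrix (Fin d) (Fin n) ℝ) (x : EuclideanSpace ℝ (Fin d))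
    (k : Fin n) : ⟪x, euclideanCol B k⟫ = ∑ i, x i * B i k := by
  simp [euclideanCol, PiLp.inner_apply, mul_comm]

/-- Expanding the columns of `B` in an eigenbasis of `B * Bᵀ` diagonalizes any quadratic form
summed over these columns. -/
theorem sum_inner_euclideanCol (B : Matrix (Fin d) (Fin n) ℝ) (hB : (B * Bᵀ).IsHermitian)
    (T : EuclideanSpace ℝ (Fin d) →L[ℝ] EuclideanSpace ℝ (Fin d)) :
    ∑ k, ⟪euclideanCol B k, T (euclideanCol B k)⟫
      = ∑ j, hB.eigenvalues j * ⟪hB.eigenvectorBasis j, T (hB.eigenvectorBasis j)⟫ := by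
  set b := hB.eigenvectorBasis
  have hgram (i j : Fin d) :
      ∑ k, ⟪b i, euclideanCol B k⟫ * ⟪b j, euclideanCol B k⟫
        = if i = j then hB.eigenvalues j else 0 := by
    have h1 : ∑ k, ⟪b i, euclideanCol B k⟫ * ⟪b j, euclideanCol B k⟫
        = (b i).ofLp ⬝ᵥ ((B * Bᵀ) *ᵥ (b j).ofLp) := by
      rw [← mulVec_mulVec, dotProduct_mulVec]
      refine Finset.sum_congr rfl fun k _ => ?_
      rw [inner_euclideanCol, inner_euclideanCol]
      congr 1
      exact Finset.sum_congr rfl fun i _ => mul_comm _ _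
    have h2 : (b i).ofLp ⬝ᵥ (b j).ofLp = if i = j then 1 else 0 := by
      rw [← orthonormal_iff_ite.1 b.orthonormal i j, PiLp.inner_apply]
      simp [dotProduct, mul_comm]
    rw [h1, hB.mulVec_eigenvectorBasis, dotProduct_smul, h2]
    simp
  have hexp (k : Fin n) : ⟪euclideanCol B k, T (euclideanCol B k)⟫
      = ∑ i, ∑ j, ⟪b i, euclideanCol B k⟫ * ⟪b j, euclideanCol B k⟫ * ⟪b j, T (b i)⟫ := by
    conv_lhs => rw [← b.sum_repr' (euclideanCol B k)]
    simp only [map_sum, map_smul, sum_inner, inner_sum, inner_smul_left, inner_smul_right]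
    simp [Finset.mul_sum, mul_assoc]
  simp only [hexp]
  rw [Finset.sum_comm]
  refine Finset.sum_congr rfl fun i _ => ?_
  rw [Finset.sum_comm]
  simp only [← Finset.sum_mul, hgram]
  simp

/-- The columns of `B` projected to the span of `Z`. -/
noncomputable def projectedCols (Z : Fin r → EuclideanSpace ℝ (Fin d))
    (B : Matrix (Fin d) (Fin n) ℝ) : Matrix (Fin d) (Fin n) ℝ :=
  Matrix.of fun i k => (Submodule.span ℝ (Set.range Z)).starProjection (euclideanCol B k) i

theorem sum_sq_projectedCols_le {α : ℝ} (hα : 0 ≤ α) (B : Matrix (Fin d) (Fin n) ℝ)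
    (hB : (B * Bᵀ).IsHermitian) {Z : Fin r → EuclideanSpace ℝ (Fin d)}
    (hZ : ∀ j, hB.eigenvalues j ≠ 0 → Z ∉ alignedFamilies α (hB.eigenvectorBasis j)) :
    ∑ i, ∑ k, projectedCols Z B i k ^ 2 ≤ α * ∑ i, ∑ k, B i k ^ 2 := by
  set W := Submodule.span ℝ (Set.range Z) with hW
  have hpos (j : Fin d) : 0 ≤ hB.eigenvalues j := by
    have : (B * Bᵀ).PosSemidef := by
      simpa [conjTranspose_eq_transpose_of_trivial] using posSemidef_self_mul_conjTranspose B
    exact this.eigenvalues_nonneg j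
  have hin (v : EuclideanSpace ℝ (Fin d)) : ⟪v, W.starProjection v⟫ = ‖W.starProjection v‖ ^ 2 := by
    rw [real_inner_comm]
    simpa using W.re_inner_starProjection_eq_normSq v
  have h1 : ∑ i, ∑ k, projectedCols Z B i k ^ 2
      = ∑ j, hB.eigenvalues j * ‖W.starProjection (hB.eigenvectorBasis j)‖ ^ 2 := by
    rw [Finset.sum_comm]
    simp only [← hin, ← sum_inner_euclideanCol B hB]
    refine Finset.sum_congr rfl fun k _ => ?_
    rw [hin, EuclideanSpace.real_norm_sq_eq]
    rfl
  have h2 : ∑ i, ∑ k, B i k ^ 2 = ∑ j, hB.eigenvalues j * ‖hB.eigenvectorBasis j‖ ^ 2 := by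
    have := sum_inner_euclideanCol B hB (ContinuousLinearMap.id ℝ _)
    simp only [ContinuousLinearMap.id_apply, real_inner_self_eq_norm_sq] at this
    rw [← this, Finset.sum_comm]
    refine Finset.sum_congr rfl fun k _ => ?_
    rw [EuclideanSpace.real_norm_sq_eq]
    rfl
  rw [h1, h2, Finset.mul_sum]
  refine Finset.sum_le_sum fun j _ => ?_
  rw [mul_left_comm]
  by_cases hj : hB.eigenvalues j = 0
  · simp [hj]
  · exact mul_le_mul_of_nonneg_left
      (norm_sq_starProjection_le_of_notMem (hZ j hj) hα) (hpos j)

theorem sum_vecMulVec_mul_projectedCols (Z : Fin r → EuclideanSpace ℝ (Fin d))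
    (B : Matrix (Fin d) (Fin n) ℝ) :
    (∑ l, vecMulVec (Z l).ofLp (Z l).ofLp) * projectedCols Z B
      = (∑ l, vecMulVec (Z l).ofLp (Z l).ofLp) * B := by
  rw [Matrix.sum_mul, Matrix.sum_mul]
  refine Finset.sum_congr rfl fun l _ => ?_
  rw [vecMulVec_mul, vecMulVec_mul]
  congr 1
  ext k
  have hl : Z l ∈ Submodule.span ℝ (Set.range Z) := Submodule.subset_span ⟨l, rfl⟩
  have h := Submodule.starProjection_inner_eq_zero (euclideanCol B k) (Z l) hl
  rw [inner_sub_left, sub_eq_zero, real_inner_comm, inner_euclideanCol, real_inner_comm,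
    PiLp.inner_apply] at h
  simpa [vecMul, dotProduct, projectedCols, mul_comm] using h.symm

theorem measure_iUnion_alignedFamilies_le (hr : 1 ≤ r) (hrd : r < d) {α : ℝ}
    (hα : α ∈ Set.Ioo (0 : ℝ) 1) (B : Matrix (Fin d) (Fin n) ℝ) (hB : (B * Bᵀ).IsHermitian) :
    (Measure.pi fun _ : Fin r => stdGaussian (EuclideanSpace ℝ (Fin d)))
        (⋃ j : {j // hB.eigenvalues j ≠ 0}, alignedFamilies α (hB.eigenvectorBasis j))
      ≤ B.rank * ENNReal.ofReal (1 - regIncBeta ((r : ℝ) / 2) (((d : ℝ) - r) / 2) α) := by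
  refine (measure_iUnion_fintype_le _ _).trans ((Finset.sum_le_card_nsmul _ _ _ fun j _ =>
    measure_alignedFamilies_le hr hrd hα
      (hB.eigenvectorBasis.orthonormal.ne_zero j.1)).trans_eq ?_)
  rw [Finset.card_univ, ← hB.rank_eq_card_non_zero_eigs, rank_self_mul_transpose, nsmul_eq_mul]

end Projection

section Mechanism

theorem regIncBeta_le_one (a b : ℝ) {α : ℝ} (hα : α ∈ Set.Ioo (0 : ℝ) 1) :
    regIncBeta a b α ≤ 1 := by
  rw [regIncBeta]
  set w : ℝ → ℝ := fun t => t ^ (a - 1) * (1 - t) ^ (b - 1)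
  by_cases hw : IntervalIntegrable w volume 0 1
  · have hnn : ∀ t ∈ Set.Icc (0 : ℝ) 1, 0 ≤ w t := fun t ht =>
      mul_nonneg (Real.rpow_nonneg ht.1 _) (Real.rpow_nonneg (sub_nonneg.2 ht.2) _)
    refine div_le_one_of_le₀ ?_ (intervalIntegral.integral_nonneg zero_le_one hnn)
    refine intervalIntegral.integral_mono_interval le_rfl hα.1.le hα.2.le ?_ hw
    exact (ae_restrict_mem measurableSet_Ioc).mono fun t ht => hnn t ⟨ht.1.le, ht.2⟩
  · rw [intervalIntegral.integral_undef hw, div_zero]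
    exact zero_le_one

variable {d r n : ℕ}

/-- The released matrix `(∑ l, z_l z_lᵀ) (V + σ E)`. -/
noncomputable def release (σ : ℝ) (V : Matrix (Fin d) (Fin n) ℝ)
    (q : (Fin r → Fin d → ℝ) × (Fin d → Fin n → ℝ)) : Fin d → Fin n → ℝ :=
  fun i k => ((∑ l, Matrix.vecMulVec (q.1 l) (q.1 l)) * (V + σ • Matrix.of q.2)) i k

theorem measurable_release (σ : ℝ) (V : Matrix (Fin d) (Fin n) ℝ) :
    Measurable (release (r := r) σ V) := by
  refine measurable_pi_iff.2 fun i => measurable_pi_iff.2 fun k => ?_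
  simp only [release, Matrix.mul_apply, Matrix.sum_apply, vecMulVec_apply, Matrix.add_apply,
    Matrix.smul_apply, Matrix.of_apply, smul_eq_mul]
  fun_prop

theorem release_eq_shift {σ : ℝ} (hσ : σ ≠ 0) (V V' : Matrix (Fin d) (Fin n) ℝ)
    (z : Fin r → Fin d → ℝ) (E : Fin d → Fin n → ℝ) :
    release σ V (z, E) = release σ V' (z, fun i k => E i k
      + projectedCols (fun l => WithLp.toLp 2 (z l)) (V - V') i k / σ) := by
  have h := sum_vecMulVec_mul_projectedCols (fun l => WithLp.toLp 2 (z l)) (V - V')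
  have hE : σ • Matrix.of (fun i k => E i k
      + projectedCols (fun l => WithLp.toLp 2 (z l)) (V - V') i k / σ)
      = σ • Matrix.of E + projectedCols (fun l => WithLp.toLp 2 (z l)) (V - V') := by
    ext i k
    simp [mul_add, mul_div_cancel₀ _ hσ]
  funext i k
  simp only [release]
  rw [hE, ← add_assoc, Matrix.mul_add _ (V' + _), h, ← Matrix.mul_add]
  rw [show V' + σ • Matrix.of E + (V - V') = V + σ • Matrix.of E by abel]

theorem gaussian_release_le_of_forall_notMem {σ : ℝ} (hσ : 0 < σ) {α : ℝ} (hα : 0 ≤ α)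
    {ε : ℝ} (hε : 0 ≤ ε) (V V' : Matrix (Fin d) (Fin n) ℝ)
    (hB : ((V - V') * (V - V')ᵀ).IsHermitian) {z : Fin r → Fin d → ℝ}
    (hz : ∀ j, hB.eigenvalues j ≠ 0 →
      (fun l => WithLp.toLp 2 (z l)) ∉ alignedFamilies α (hB.eigenvectorBasis j))
    {T : ℝ} (hT : T = α * (∑ i, ∑ k, (V - V') i k ^ 2) / σ ^ 2)
    {A : Set (Fin d → Fin n → ℝ)} (hA : MeasurableSet A) :
    (Measure.pi fun _ : Fin d => Measure.pi fun _ : Fin n => gaussianReal 0 1)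
        {E | release σ V (z, E) ∈ A}
      ≤ ENNReal.ofReal (Real.exp ε)
          * (Measure.pi fun _ : Fin d => Measure.pi fun _ : Fin n => gaussianReal 0 1)
            {E | release σ V' (z, E) ∈ A}
        + ENNReal.ofReal (1 - Phi ((ε - T / 2) / √T)) := by
  simp only [release_eq_shift hσ.ne' V V' z]
  refine pi_pi_gaussianReal_shift_le (fun i k =>
    projectedCols (fun l => WithLp.toLp 2 (z l)) (V - V') i k / σ) ?_ hε
    (hA.preimage ((measurable_release σ V').comp (by fun_prop)))
  simp only [div_pow, ← Finset.sum_div]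
  rw [hT]
  gcongr
  exact sum_sq_projectedCols_le hα _ hB hz

theorem gaussian_prod_release_le (hr : 1 ≤ r) (hrd : r < d) {σ : ℝ} (hσ : 0 < σ) {α : ℝ}
    (hα : α ∈ Set.Ioo (0 : ℝ) 1) {ε : ℝ} (hε : 0 ≤ ε) (V V' : Matrix (Fin d) (Fin n) ℝ)
    {T : ℝ} (hT : T = α * (∑ i, ∑ k, (V - V') i k ^ 2) / σ ^ 2)
    {A : Set (Fin d → Fin n → ℝ)} (hA : MeasurableSet A)
    (P : Measure ((Fin r → Fin d → ℝ) × (Fin d → Fin n → ℝ)))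
    (hP : P = (Measure.pi fun _ : Fin r => Measure.pi fun _ : Fin d => gaussianReal 0 1).prod
      (Measure.pi fun _ : Fin d => Measure.pi fun _ : Fin n => gaussianReal 0 1)) :
    P {q | release σ V q ∈ A}
      ≤ ENNReal.ofReal (Real.exp ε) * P {q | release σ V' q ∈ A}
        + (ENNReal.ofReal (1 - Phi ((ε - T / 2) / √T)) + (V - V').rank
          * ENNReal.ofReal (1 - regIncBeta ((r : ℝ) / 2) (((d : ℝ) - r) / 2) α)) := by
  set ν := Measure.pi fun _ : Fin r => Measure.pi fun _ : Fin d => gaussianReal 0 1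
  set ρ := Measure.pi fun _ : Fin d => Measure.pi fun _ : Fin n => gaussianReal 0 1
  have hB : ((V - V') * (V - V')ᵀ).IsHermitian := by
    simpa using isHermitian_mul_conjTranspose_self (V - V')
  set bad : Set (Fin r → Fin d → ℝ) := {z | (fun l => WithLp.toLp 2 (z l)) ∈
    ⋃ j : {j // hB.eigenvalues j ≠ 0}, alignedFamilies α (hB.eigenvectorBasis j)} with hbad
  have hmp : MeasurePreserving (fun (z : Fin r → Fin d → ℝ) l => WithLp.toLp 2 (z l)) ν
      (Measure.pi fun _ => stdGaussian (EuclideanSpace ℝ (Fin d))) :=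
    measurePreserving_pi _ _ fun _ => ⟨by fun_prop, map_pi_eq_stdGaussian⟩
  have hopen : IsOpen (⋃ j : {j // hB.eigenvalues j ≠ 0},
      alignedFamilies (r := r) α (hB.eigenvectorBasis j)) :=
    isOpen_iUnion fun j => (isOpen_setOf_mem_alignedFamilies α).preimage
      (Continuous.prodMk continuous_id continuous_const)
  have hbadle : ν bad ≤ (V - V').rank
      * ENNReal.ofReal (1 - regIncBeta ((r : ℝ) / 2) (((d : ℝ) - r) / 2) α) := by
    refine le_trans (le_of_eq ?_) (measure_iUnion_alignedFamilies_le hr hrd hα (V - V') hB)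
    exact hmp.measure_preimage hopen.measurableSet.nullMeasurableSet
  have hbadm : MeasurableSet bad := hopen.measurableSet.preimage hmp.measurable
  have hV (U : Matrix (Fin d) (Fin n) ℝ) : MeasurableSet
      {q : (Fin r → Fin d → ℝ) × (Fin d → Fin n → ℝ) | release σ U q ∈ A} :=
    hA.preimage (measurable_release σ U)
  have hpt (z : Fin r → Fin d → ℝ) : ρ {E | release σ V (z, E) ∈ A}
      ≤ ENNReal.ofReal (Real.exp ε) * ρ {E | release σ V' (z, E) ∈ A}
        + (ENNReal.ofReal (1 - Phi ((ε - T / 2) / √T)) + bad.indicator 1 z) := by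
    by_cases hz : z ∈ bad
    · rw [Set.indicator_of_mem hz]
      exact prob_le_one.trans (le_add_left (le_add_left le_rfl))
    · rw [Set.indicator_of_notMem hz, add_zero]
      refine gaussian_release_le_of_forall_notMem hσ hα.1.le hε V V' hB (fun j hj h => hz ?_) hT hA
      exact Set.mem_iUnion.2 ⟨⟨j, hj⟩, h⟩
  have hm : Measurable fun z => ρ {E | release (r := r) σ V' (z, E) ∈ A} :=
    measurable_measure_prodMk_left (hV V')
  rw [hP, Measure.prod_apply (hV V), Measure.prod_apply (hV V')]
  refine (lintegral_mono hpt).trans ?_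
  rw [lintegral_add_left (hm.const_mul _), lintegral_const_mul _ hm,
    lintegral_add_left measurable_const, lintegral_indicator_one hbadm, lintegral_const,
    measure_univ, mul_one]
  gcongr
  exact le_rfl

end Mechanism

end

/-- DP of the noisy matrix projection mechanism in the small-`r` regime.
For `M = Σ zᵢ zᵢᵀ` with `zᵢ` i.i.d. `N(0, I_d)`, independent Gaussian noise `E`, and
neighboring `V, V'` with `ΔV ≠ 0` of rank `s`, the releases `Y = M(V + σE)` and
`Y' = M(V' + σE)` satisfy `ℙ(Y ∈ A) ≤ e^ε ℙ(Y' ∈ A) + δ_E(ε,α) + δ_M`. -/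
theorem stmt16
    {Ω : Type} [MeasureSpace Ω] [IsProbabilityMeasure (ℙ : Measure Ω)]
    (d r n : ℕ) (hr : 1 ≤ r) (hrd : r ≤ d - 1) (hd : 1 ≤ d) (hn : 1 ≤ n)
    (σ : ℝ) (hσ : 0 < σ)
    (z : Ω → Fin r → Fin d → ℝ)
    (E : Ω → Fin d → Fin n → ℝ)
    -- joint law: `z` has i.i.d. `N(0, I_d)` columns, `E` i.i.d. `N(0,1)` entries,
    -- and they are independent
    (hzE : Measure.map (fun ω => (z ω, E ω)) ℙ
      = (Measure.pi fun _ : Fin r => Measure.pi fun _ : Fin d => gaussianReal 0 1).prod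
          (Measure.pi fun _ : Fin d => Measure.pi fun _ : Fin n => gaussianReal 0 1))
    (V V' : Matrix (Fin d) (Fin n) ℝ) (hVV' : V ≠ V')
    (s : ℕ) (hs : (V - V').rank = s)
    (ε : ℝ) (hε : 0 < ε) (α : ℝ) (hα : α ∈ Set.Ioo (0 : ℝ) 1)
    (μbar : ℝ) (hμbar : μbar = α * (∑ i, ∑ k, ((V - V') i k) ^ 2) / σ ^ 2)
    (δE : ℝ)
    (hδE : δE = Phi ((-ε - μbar / 2) / Real.sqrt μbar)
      + (1 - Phi ((ε - μbar / 2) / Real.sqrt μbar)))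
    (δM : ℝ) (hδM : δM = s * (1 - regIncBeta (r / 2) (((d : ℝ) - r) / 2) α)) :
    ∀ A : Set (Fin d → Fin n → ℝ), MeasurableSet A →
      ℙ {ω | (fun i k =>
          ((∑ l, Matrix.vecMulVec (z ω l) (z ω l)) * (V + σ • Matrix.of (E ω))) i k) ∈ A}
        ≤ ENNReal.ofReal (Real.exp ε)
            * ℙ {ω | (fun i k =>
                ((∑ l, Matrix.vecMulVec (z ω l) (z ω l))
                  * (V' + σ • Matrix.of (E ω))) i k) ∈ A}
          + ENNReal.ofReal (δE + δM) := by
  intro A hA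
  have hrd' : r < d := by omega
  have hae : AEMeasurable (fun ω => (z ω, E ω)) ℙ := by
    refine AEMeasurable.of_map_ne_zero ?_
    rw [hzE]
    exact IsProbabilityMeasure.ne_zero _
  have hmap (U : Matrix (Fin d) (Fin n) ℝ) :
      Measure.map (fun ω => (z ω, E ω)) ℙ {q | release σ U q ∈ A}
        = ℙ {ω | (fun i k => ((∑ l, Matrix.vecMulVec (z ω l) (z ω l))
          * (U + σ • Matrix.of (E ω))) i k) ∈ A} :=
    Measure.map_apply_of_aemeasurable hae (hA.preimage (measurable_release σ U))
  rw [← hmap V, ← hmap V']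
  refine (gaussian_prod_release_le hr hrd' hσ hα hε.le V V' hμbar hA _ hzE).trans ?_
  gcongr
  rw [hs, ← ENNReal.ofReal_natCast]
  have hβ : 0 ≤ 1 - regIncBeta ((r : ℝ) / 2) (((d : ℝ) - r) / 2) α :=
    sub_nonneg.2 (regIncBeta_le_one _ _ hα)
  rw [← ENNReal.ofReal_mul (Nat.cast_nonneg _),
    ← ENNReal.ofReal_add (sub_nonneg.2 (Phi_le_one _)) (by positivity), hδE, hδM]
  refine ENNReal.ofReal_le_ofReal ?_
  linarith [Phi_nonneg ((-ε - μbar / 2) / √μbar)]
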